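/- (Strict Hardy constant improvement on an annular cylinder in the y-variable) Let m ≥ 3 and 0 < r < R < ∞, and let ω = {y ∈ ℝᵐ : r < |y| < R}. Then inf { ∫_ω |∇v|² dy : v ∈ C_0^∞(ω), ∫_ω v²/|y|² dy = 1 } > ((m−2)/2)², i.e., the Hardy constant on the annulus ω strictly exceeds the global Hardy constant ((m−2)/2)² on ℝᵐ \ {0}. -/

import Mathlib

open MeasureTheory

section Hardy

variable {E : Type*} [NormedAddCommGroup E] [InnerProductSpace ℝ E]

/-- A smooth function whose topological support avoids `0` stays smooth after multiplication by a
function that is smooth away from `0`. -/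
theorem ContDiff.mul_of_zero_notMem_tsupport {n : WithTop ℕ∞} {f g : E → ℝ}
    (hf : ContDiff ℝ n f) (h0 : (0 : E) ∉ tsupport f) (hg : ∀ y ≠ 0, ContDiffAt ℝ n g y) :
    ContDiff ℝ n (fun y ↦ f y * g y) := by
  rw [contDiff_iff_contDiffAt]
  intro y
  by_cases hy : y ∈ tsupport f
  · exact hf.contDiffAt.mul (hg y (ne_of_mem_of_not_mem hy h0))
  · rw [notMem_tsupport_iff_eventuallyEq] at hy
    refine (contDiffAt_const (c := (0 : ℝ))).congr_of_eventuallyEq ?_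
    filter_upwards [hy] with z hz
    simp [hz]

/-- The derivative of `y ↦ (c + a log ‖y‖²) / ‖y‖²`. -/
theorem hasFDerivAt_log_norm_sq_div (c a : ℝ) {y : E} (hy : y ≠ 0) :
    HasFDerivAt (fun y : E ↦ (c + a * Real.log (‖y‖ ^ 2)) / ‖y‖ ^ 2)
      (((a - (c + a * Real.log (‖y‖ ^ 2))) / (‖y‖ ^ 2) ^ 2) • (2 • innerSL ℝ y)) y := by
  have hs : ‖y‖ ^ 2 ≠ 0 := by positivity
  have hQ : HasDerivAt (fun s : ℝ ↦ (c + a * Real.log s) / s)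
      ((a - (c + a * Real.log (‖y‖ ^ 2))) / (‖y‖ ^ 2) ^ 2) (‖y‖ ^ 2) := by
    refine ((((Real.hasDerivAt_log hs).const_mul a).const_add c).div
      (hasDerivAt_id _) hs).congr_deriv ?_
    rw [id_eq, mul_assoc, inv_mul_cancel₀ hs, mul_one, mul_one]
  exact hQ.comp_hasFDerivAt y (hasStrictFDerivAt_norm_sq y).hasFDerivAt

/-- The pointwise inequality behind the improved Hardy inequality. -/
theorem hardy_pointwise {c a K s S h v D N : ℝ} (hs : 0 < s) (hSK : S ^ 2 ≤ K)
    (ha : a * (1 + K) = 1) (hh : h = c + a * S) (hD : D ^ 2 ≤ N ^ 2 * s) :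
    (c ^ 2 + a) * (v ^ 2 / s) -
      ((2 * c + 2) * (v ^ 2 * (h / s)) + (2 * v * D * (h / s) + v ^ 2 * (2 * (a - h) / s)))
      ≤ N ^ 2 := by
  have hK : 0 ≤ K := (sq_nonneg S).trans hSK
  have hN : D ^ 2 / s ≤ N ^ 2 := by rwa [div_le_iff₀ hs]
  have hsq : 0 ≤ (D + v * h) ^ 2 / s := by positivity
  have haS : 0 ≤ a - a ^ 2 * S ^ 2 := by
    have ha0 : 0 ≤ a := by
      by_contra! hneg
      nlinarith
    have : a ^ 2 * S ^ 2 ≤ a ^ 2 * K := by gcongr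
    nlinarith
  have hrem : 0 ≤ v ^ 2 / s * (a - a ^ 2 * S ^ 2) := by positivity
  have key : D ^ 2 / s - ((c ^ 2 + a) * (v ^ 2 / s) -
      ((2 * c + 2) * (v ^ 2 * (h / s)) + (2 * v * D * (h / s) + v ^ 2 * (2 * (a - h) / s))))
      = (D + v * h) ^ 2 / s + v ^ 2 / s * (a - a ^ 2 * S ^ 2) := by
    subst hh
    field_simp
    ring
  linarith

theorem continuous_hasCompactSupport_sq_div_norm_sq {v : E → ℝ} (hv : ContDiff ℝ 1 v) (hc : HasCompactSupport v)
    (h0 : (0 : E) ∉ tsupport v) :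
    Continuous (fun y ↦ v y ^ 2 / ‖y‖ ^ 2) ∧ HasCompactSupport (fun y ↦ v y ^ 2 / ‖y‖ ^ 2) := by
  have heq : (fun y ↦ v y ^ 2 / ‖y‖ ^ 2) = fun y ↦ v y * (v y / ‖y‖ ^ 2) := by
    ext y
    ring
  rw [heq]
  refine ⟨(hv.mul_of_zero_notMem_tsupport h0 fun y hy ↦ ?_).continuous, hc.mul_right⟩
  exact hv.contDiffAt.div (contDiff_norm_sq ℝ).contDiffAt (by positivity)

variable [FiniteDimensional ℝ E] [MeasurableSpace E] [BorelSpace E]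

/-- The divergence theorem for the radial field `y ↦ u y • y`. -/
theorem integral_finrank_mul_add_fderiv_self {u : E → ℝ} (hu : ContDiff ℝ 1 u)
    (hc : HasCompactSupport u) :
    ∫ y, ((Module.finrank ℝ E : ℝ) * u y + fderiv ℝ u y y) = 0 := by
  have hdu : Continuous (fderiv ℝ u) := hu.continuous_fderiv one_ne_zero
  have hiu : Integrable u := hu.continuous.integrable_of_hasCompactSupport hc
  set b := stdOrthonormalBasis ℝ E
  have hi (i) : Integrable (fun y ↦ innerSL ℝ (b i) y * fderiv ℝ u y (b i)) :=
    (by fun_prop : Continuous _).integrable_of_hasCompactSupport (hc.fderiv_apply ℝ (b i)).mul_left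
  have hf (i) (y : E) : fderiv ℝ (fun w ↦ inner ℝ (b i) w) y (b i) = 1 := by
    have : fderiv ℝ (fun w ↦ inner ℝ (b i) w) y = innerSL ℝ (b i) := (innerSL ℝ (b i)).fderiv
    simp [this]
  have hparts (i) : ∫ y, innerSL ℝ (b i) y * fderiv ℝ u y (b i) = - ∫ y, u y := by
    rw [integral_mul_fderiv_eq_neg_fderiv_mul_of_integrable]
    · simp [hf i]
    · simpa [hf i] using hiu
    · exact hi i
    · exact (by fun_prop : Continuous _).integrable_of_hasCompactSupport hc.mul_left
    · exact fun x _ ↦ (innerSL ℝ (b i)).differentiableAt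
    · exact fun x _ ↦ (hu.differentiable one_ne_zero) x
  have hsum (y : E) : fderiv ℝ u y y = ∑ i, innerSL ℝ (b i) y * fderiv ℝ u y (b i) := by
    conv_lhs => arg 2; rw [← b.sum_repr' y]
    simp [map_sum]
  simp_rw [hsum]
  rw [integral_add (hiu.const_mul _) (integrable_finsetSum _ fun i _ ↦ hi i), integral_const_mul,
    integral_finsetSum _ fun i _ ↦ hi i]
  simp_rw [hparts]
  simp

/-- The Hardy inequality with an improved constant for functions supported in a region on which
`log ‖y‖²` is bounded. -/
theorem improved_hardy {c a K : ℝ} (hdim : (Module.finrank ℝ E : ℝ) = 2 * c + 2)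
    (ha : a * (1 + K) = 1) {v : E → ℝ} (hv : ContDiff ℝ 1 v) (hc : HasCompactSupport v)
    (h0 : (0 : E) ∉ tsupport v) (hK : ∀ y ∈ tsupport v, Real.log (‖y‖ ^ 2) ^ 2 ≤ K) :
    (c ^ 2 + a) * ∫ y, v y ^ 2 / ‖y‖ ^ 2 ≤ ∫ y, ‖fderiv ℝ v y‖ ^ 2 := by
  set q : E → ℝ := fun y ↦ (c + a * Real.log (‖y‖ ^ 2)) / ‖y‖ ^ 2 with hq
  set u : E → ℝ := fun y ↦ v y * (v y * q y) with hu
  have hucd : ContDiff ℝ 1 u := hv.mul_of_zero_notMem_tsupport h0 fun y hy ↦ by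
    have hs : ‖y‖ ^ 2 ≠ 0 := by positivity
    have hn : ContDiffAt ℝ 1 (fun y : E ↦ ‖y‖ ^ 2) y := (contDiff_norm_sq ℝ).contDiffAt
    exact hv.contDiffAt.mul ((contDiffAt_const.add (contDiffAt_const.mul (hn.log hs))).div hn hs)
  have huc : HasCompactSupport u := hc.mul_right
  have hdu : Continuous (fderiv ℝ u) := hucd.continuous_fderiv one_ne_zero
  obtain ⟨hwc, hws⟩ := continuous_hasCompactSupport_sq_div_norm_sq hv hc h0
  have hiw := (hwc.integrable_of_hasCompactSupport (μ := volume) hws).const_mul (c ^ 2 + a)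
  have hidu : Integrable (fun y ↦ fderiv ℝ u y y) :=
    (by fun_prop : Continuous _).integrable_of_hasCompactSupport
      ((huc.fderiv ℝ).mono fun y hy h ↦ hy (by simp [h]))
  have hidiv : Integrable (fun y ↦ (Module.finrank ℝ E : ℝ) * u y + fderiv ℝ u y y) :=
    ((hucd.continuous.integrable_of_hasCompactSupport huc).const_mul _).add hidu
  have higrad : Integrable (fun y ↦ ‖fderiv ℝ v y‖ ^ 2) :=
    ((hv.continuous_fderiv one_ne_zero).norm.pow 2).integrable_of_hasCompactSupport
      ((hc.fderiv ℝ).mono fun y hy h ↦ hy (by simp [h]))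
  calc (c ^ 2 + a) * ∫ y, v y ^ 2 / ‖y‖ ^ 2
      = ∫ y, ((c ^ 2 + a) * (v y ^ 2 / ‖y‖ ^ 2) -
          ((Module.finrank ℝ E : ℝ) * u y + fderiv ℝ u y y)) := by
        rw [integral_sub hiw hidiv, integral_finrank_mul_add_fderiv_self hucd huc,
          integral_const_mul, sub_zero]
    _ ≤ ∫ y, ‖fderiv ℝ v y‖ ^ 2 := by
        refine integral_mono (hiw.sub hidiv) higrad fun y ↦ ?_
        by_cases hy : y ∈ tsupport v
        · have hy0 : y ≠ 0 := ne_of_mem_of_not_mem hy h0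
          have hs : 0 < ‖y‖ ^ 2 := by positivity
          have hdv := (hv.differentiable one_ne_zero y).hasFDerivAt
          have hder : fderiv ℝ u y y = 2 * v y * fderiv ℝ v y y * q y +
              v y ^ 2 * (2 * (a - (c + a * Real.log (‖y‖ ^ 2))) / ‖y‖ ^ 2) := by
            have hdu : HasFDerivAt u _ y :=
              hdv.mul (hdv.mul (hasFDerivAt_log_norm_sq_div c a hy0))
            rw [hdu.fderiv]
            simp [hq]
            field_simp
            ring
          have hD : fderiv ℝ v y y ^ 2 ≤ ‖fderiv ℝ v y‖ ^ 2 * ‖y‖ ^ 2 := by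
            rw [← mul_pow, ← sq_abs, ← Real.norm_eq_abs]
            gcongr
            exact (fderiv ℝ v y).le_opNorm y
          have huy : u y = v y ^ 2 * q y := by
            simp only [hu]
            ring
          simp only [hder, hdim, huy]
          exact hardy_pointwise (c := c) (v := v y) hs (hK y hy) ha rfl hD
        · have hv0 : v y = 0 := image_eq_zero_of_notMem_tsupport hy
          have hu0 : fderiv ℝ u y = 0 := by
            refine image_eq_zero_of_notMem_tsupport fun h ↦ hy ?_
            exact closure_mono (Function.support_mul_subset_left v _)
              (tsupport_fderiv_subset ℝ h)
          simp [show u y = 0 by simp [hu, hv0], hv0, hu0]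

/-- Every nonempty annulus with positive inner radius supports a normalised test function. -/
theorem exists_normalized_annulus_test_function [Nontrivial E] {r R : ℝ} (hr : 0 < r)
    (hrR : r < R) :
    ∃ v : E → ℝ, ContDiff ℝ (⊤ : ℕ∞) v ∧ HasCompactSupport v ∧
      tsupport v ⊆ {y : E | r < ‖y‖ ∧ ‖y‖ < R} ∧ (∫ y, (v y) ^ 2 / ‖y‖ ^ 2) = 1 := by
  obtain ⟨p, hp⟩ := exists_norm_eq E (show 0 ≤ (r + R) / 2 by linarith)
  let φ : ContDiffBump p := ⟨(R - r) / 8, (R - r) / 4, by linarith, by linarith⟩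
  have hφ : ContDiff ℝ (⊤ : ℕ∞) φ := φ.contDiff
  have hsub : tsupport φ ⊆ {y : E | r < ‖y‖ ∧ ‖y‖ < R} := by
    intro y hy
    rw [φ.tsupport_eq, Metric.mem_closedBall, dist_eq_norm] at hy
    have hy' : ‖y - p‖ ≤ (R - r) / 4 := hy
    have h1 := norm_sub_norm_le y p
    have h2 := norm_sub_norm_le p y
    rw [norm_sub_rev] at h2
    constructor <;> linarith
  have h0 : (0 : E) ∉ tsupport φ := fun h ↦ by
    have := (hsub h).1
    rw [norm_zero] at this
    linarith
  obtain ⟨hwc, hws⟩ := continuous_hasCompactSupport_sq_div_norm_sq (hφ.of_le (by simp)) φ.hasCompactSupport h0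
  have hpos : 0 < ∫ y, φ y ^ 2 / ‖y‖ ^ 2 := by
    refine hwc.integral_pos_of_hasCompactSupport_nonneg_nonzero (x := p) hws
      (fun y ↦ by positivity) ?_
    have hp0 : 0 < ‖p‖ := by rw [hp]; linarith
    have hφp : 0 < φ p := φ.pos_of_mem_ball (Metric.mem_ball_self φ.rOut_pos)
    positivity
  set I := ∫ y, φ y ^ 2 / ‖y‖ ^ 2 with hI
  refine ⟨fun y ↦ (√I)⁻¹ * φ y, contDiff_const.mul hφ, φ.hasCompactSupport.mul_left,
    (closure_mono (Function.support_mul_subset_right _ _)).trans hsub, ?_⟩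
  have (y : E) : ((√I)⁻¹ * φ y) ^ 2 / ‖y‖ ^ 2 = I⁻¹ * (φ y ^ 2 / ‖y‖ ^ 2) := by
    rw [mul_pow, inv_pow, Real.sq_sqrt hpos.le, mul_div_assoc]
  simp_rw [this]
  rw [integral_const_mul, ← hI, inv_mul_cancel₀ hpos.ne']

end Hardy

theorem stmt17 (m : ℕ) (hm : 3 ≤ m) (r R : ℝ) (hr : 0 < r) (hrR : r < R) :
    sInf {e : ℝ | ∃ v : EuclideanSpace ℝ (Fin m) → ℝ,
        ContDiff ℝ (⊤ : ℕ∞) v ∧ HasCompactSupport v ∧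
        tsupport v ⊆ {y : EuclideanSpace ℝ (Fin m) | r < ‖y‖ ∧ ‖y‖ < R} ∧
        (∫ y, (v y) ^ 2 / ‖y‖ ^ 2) = 1 ∧
        e = ∫ y, ‖fderiv ℝ v y‖ ^ 2} >
      (((m : ℝ) - 2) / 2) ^ 2 := by
  have : NeZero m := ⟨by lia⟩
  set K := Real.log (r ^ 2) ^ 2 + Real.log (R ^ 2) ^ 2 with hK
  have hK0 : 0 < 1 + K := by positivity
  refine lt_of_lt_of_le (lt_add_of_pos_right _ (inv_pos.2 hK0)) (le_csInf ?_ ?_)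
  · obtain ⟨v, h1, h2, h3, h4⟩ :=
      exists_normalized_annulus_test_function (E := EuclideanSpace ℝ (Fin m)) hr hrR
    exact ⟨_, v, h1, h2, h3, h4, rfl⟩
  · rintro _ ⟨v, hv, hc, hsub, hnorm, rfl⟩
    have hardy := improved_hardy (c := ((m : ℝ) - 2) / 2) (K := K) (by simp; ring)
      (inv_mul_cancel₀ hK0.ne') (hv.of_le (by simp)) hc
      (fun h ↦ by
        have := (hsub h).1
        rw [norm_zero] at this
        linarith)
      (fun y hy ↦ by
        obtain ⟨h1, h2⟩ := hsub hy
        have hlo : Real.log (r ^ 2) ≤ Real.log (‖y‖ ^ 2) := by gcongr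
        have hhi : Real.log (‖y‖ ^ 2) ≤ Real.log (R ^ 2) := by
          have : 0 < ‖y‖ := hr.trans h1
          gcongr
        rcases le_total 0 (Real.log (‖y‖ ^ 2)) with h | h <;> nlinarith)
    rwa [hnorm, mul_one] at hardy
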